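/- Assume in addition that α > 3, the step-size is constant s_k ≡ s ∈ (0, 1/L], β_k ≡ β = η √s/2 for some η ∈ (0,1], and Assumption (J0) holds. Then Σ_{k≥1} k ‖x_k − x_{k−1}‖² < ∞. -/

import Mathlib

set_option autoImplicit false

open Finset in
/-- A deterministic Robbins–Siegmund lemma. -/
lemma summable_of_le_one_add_mul {a D h ε : ℕ → ℝ} (ha : ∀ n, 0 ≤ a n) (hD : ∀ n, 0 ≤ D n)
    (hh : ∀ n, 0 ≤ h n) (hε : ∀ n, 0 ≤ ε n) (sh : Summable h) (sε : Summable ε)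
    (hrec : ∀ n, a (n + 1) ≤ (1 + ε n) * (a n - D n + h n)) : Summable D := by
  have key : ∀ n, a n + ∑ i ∈ range n, D i ≤
      (∏ i ∈ range n, (1 + ε i)) * (a 0 + ∑ i ∈ range n, h i) := by
    intro n
    induction n with
    | zero => simp
    | succ n ih =>
      rw [sum_range_succ, prod_range_succ, sum_range_succ]
      have hP : 1 ≤ ∏ i ∈ range n, (1 + ε i) :=
        le_of_eq_of_le prod_const_one.symm
          (prod_le_prod (fun _ _ => zero_le_one) fun i _ => by linarith [hε i])
      have h1 : a (n + 1) + (∑ i ∈ range n, D i + D n) ≤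
          (1 + ε n) * (a n + ∑ i ∈ range n, D i + h n) := by
        have := mul_nonneg (hε n) (sum_nonneg fun i (_ : i ∈ range n) => hD i)
        have := mul_nonneg (hε n) (hD n)
        nlinarith [hrec n]
      have h2 : a n + ∑ i ∈ range n, D i + h n ≤
          (∏ i ∈ range n, (1 + ε i)) * (a 0 + (∑ i ∈ range n, h i + h n)) := by
        nlinarith [hh n]
      calc _ ≤ _ := h1
        _ ≤ _ := mul_le_mul_of_nonneg_left h2 (by linarith [hε n])
        _ = _ := by ring
  refine summable_of_sum_range_le (c := Real.exp (∑' i, ε i) * (a 0 + ∑' i, h i)) hD fun n => ?_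
  have hsum : ∑ i ∈ range n, h i ≤ ∑' i, h i := sh.sum_le_tsum _ fun i _ => hh i
  have hprod : ∏ i ∈ range n, (1 + ε i) ≤ Real.exp (∑' i, ε i) :=
    (Real.prod_one_add_le_exp_sum _ fun i => hε i).trans
      (Real.exp_le_exp.2 (sε.sum_le_tsum _ fun i _ => hε i))
  have h0 : 0 ≤ a 0 + ∑ i ∈ range n, h i := add_nonneg (ha 0) (sum_nonneg fun i _ => hh i)
  calc ∑ i ∈ range n, D i ≤ a n + ∑ i ∈ range n, D i := by linarith [ha n]
    _ ≤ _ := key n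
    _ ≤ _ := mul_le_mul hprod (by linarith) h0 (Real.exp_nonneg _)

lemma summable_of_le_one_add_mul_of_ge {a D h ε : ℕ → ℝ} (N : ℕ) (ha : ∀ n, 0 ≤ a n)
    (hD : ∀ n, 0 ≤ D n) (hh : ∀ n, 0 ≤ h n) (hε : ∀ n, 0 ≤ ε n) (sh : Summable h)
    (sε : Summable ε) (hrec : ∀ n, N ≤ n → a (n + 1) ≤ (1 + ε n) * (a n - D n + h n)) :
    Summable D := by
  rw [← summable_nat_add_iff N]
  refine summable_of_le_one_add_mul (a := fun n => a (n + N)) (h := fun n => h (n + N))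
    (ε := fun n => ε (n + N)) (fun n => ha _) (fun n => hD _) (fun n => hh _) (fun n => hε _)
    ((summable_nat_add_iff N).2 sh) ((summable_nat_add_iff N).2 sε) fun n => ?_
  have := hrec (n + N) (by omega)
  rwa [show n + 1 + N = n + N + 1 by ring]

lemma Summable.sq_of_nonneg {u : ℕ → ℝ} (hu : ∀ n, 0 ≤ u n) (hs : Summable u) :
    Summable fun n => u n ^ 2 := by
  refine Summable.of_nonneg_of_le (fun n => sq_nonneg _) (fun n => ?_) (hs.mul_left (∑' i, u i))
  rw [sq]
  exact mul_le_mul_of_nonneg_right (hs.le_tsum n fun i _ => hu i) (hu n)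

section InnerProduct

variable {H : Type*} [NormedAddCommGroup H] [InnerProductSpace ℝ H]

lemma two_mul_inner_le (u v : H) : 2 * inner ℝ u v ≤ ‖u‖ ^ 2 + ‖v‖ ^ 2 := by
  nlinarith [norm_sub_sq_real u v, sq_nonneg ‖u - v‖]

lemma neg_two_mul_inner_le (u v : H) : -(2 * inner ℝ u v) ≤ ‖u‖ ^ 2 + ‖v‖ ^ 2 := by
  nlinarith [norm_add_sq_real u v, sq_nonneg ‖u + v‖]

lemma norm_add_sq_le_two_mul (u v : H) : ‖u + v‖ ^ 2 ≤ 2 * ‖u‖ ^ 2 + 2 * ‖v‖ ^ 2 := by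
  linarith [norm_add_sq_real u v, two_mul_inner_le u v]

lemma half_norm_sub_smul_sq_le (v e : H) {t : ℝ} (ht : 0 ≤ t) :
    ‖v - t • e‖ ^ 2 / 2 ≤ (1 + t * ‖e‖) * (‖v‖ ^ 2 / 2 + t * ‖e‖ / 2) := by
  have h1 : ‖v - t • e‖ ≤ ‖v‖ + t * ‖e‖ := by
    simpa [norm_smul, abs_of_nonneg ht] using norm_sub_le v (t • e)
  have hε : 0 ≤ t * ‖e‖ := by positivity
  have h2 : ‖v - t • e‖ ^ 2 ≤ (‖v‖ + t * ‖e‖) ^ 2 := by gcongr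
  nlinarith [mul_nonneg hε (sq_nonneg (‖v‖ - 1))]

/-- One-step decrease of the main energy, before the gradient error is taken into account. -/
lemma energy_step_le {u g p M q : H} {k a b s F F' E : ℝ} (hs : 0 < s) (hb : 0 < b)
    (hbs : b ≤ s / 2) (ha : 2 < a) (hk : 4 * a ≤ k) (hF : 0 ≤ F)
    (h1 : F' ≤ F + inner ℝ p u - s / 2 * ‖p‖ ^ 2 - s / 2 * ‖g - p‖ ^ 2 + s / 2 * E)
    (h2 : F' ≤ inner ℝ p (u + q) - s * ‖p‖ ^ 2 + s / 2 * E) :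
    ‖k • (u + b • (g + M)) + a • q - (k * s) • p‖ ^ 2 / 2 + s * k ^ 2 * F' ≤
      ‖k • (u + b • (g + M)) + a • q‖ ^ 2 / 2 + s * (k - 1) ^ 2 * F
        - (s * (a - 2) * (k * F) + s * b / 8 * (k ^ 2 * (‖g‖ ^ 2 + ‖p‖ ^ 2)))
        + (s ^ 2 / 2 * (k ^ 2 * E) + 2 * s * b * (k ^ 2 * ‖M‖ ^ 2)) := by
  rw [norm_sub_sq_real (k • (u + b • (g + M)) + a • q)]
  have e1 : inner ℝ (k • (u + b • (g + M)) + a • q) ((k * s) • p) =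
      k * s * (k * (inner ℝ p u + b * (inner ℝ p g + inner ℝ p M)) + a * inner ℝ p q) := by
    rw [real_inner_comm]
    simp only [inner_add_right, real_inner_smul_left, real_inner_smul_right]
    ring
  have e2 : ‖(k * s) • p‖ ^ 2 = k ^ 2 * s ^ 2 * ‖p‖ ^ 2 := by
    rw [norm_smul, mul_pow, Real.norm_eq_abs, sq_abs]; ring
  rw [e1, e2]
  rw [norm_sub_sq_real, real_inner_comm p g] at h1
  rw [inner_add_right] at h2
  have hc1 := two_mul_inner_le p g
  have hc2 := neg_two_mul_inner_le p g
  have hm : -inner ℝ p M ≤ ‖p‖ ^ 2 / 8 + 2 * ‖M‖ ^ 2 := by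
    have := neg_two_mul_inner_le p ((4 : ℝ) • M)
    rw [inner_smul_right, norm_smul] at this
    norm_num at this
    nlinarith
  have hA : 0 ≤ ‖p‖ ^ 2 := sq_nonneg _
  have hB : 0 ≤ ‖g‖ ^ 2 := sq_nonneg _
  have hN : 0 ≤ ‖M‖ ^ 2 := sq_nonneg _
  generalize ‖k • (u + b • (g + M)) + a • q‖ ^ 2 = W
  generalize ‖p‖ ^ 2 = A at *
  generalize ‖g‖ ^ 2 = B at *
  generalize ‖M‖ ^ 2 = N at *
  generalize inner ℝ p u = I at *
  generalize inner ℝ p q = J at *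
  generalize inner ℝ p g = c at *
  generalize inner ℝ p M = m at *
  clear e1 e2
  have hk0 : 0 < k := by linarith
  have hka : 0 ≤ k * (k - a) := mul_nonneg hk0.le (by linarith)
  have t1 := mul_le_mul_of_nonneg_left h1 hka
  have t2 := mul_le_mul_of_nonneg_left h2 (mul_nonneg hk0.le (by linarith : 0 ≤ a))
  have r1 : b / 2 * (A + B) ≤ b * c + s / 2 * (B - 2 * c + A) := by
    nlinarith [mul_nonneg (by linarith : 0 ≤ s / 2 - b) (by linarith : 0 ≤ B - 2 * c + A)]
  have t3 := mul_le_mul_of_nonneg_left r1 hka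
  have t4 := mul_le_mul_of_nonneg_left (by linarith : -c ≤ (A + B) / 2)
    (by positivity : 0 ≤ k * a * b)
  have t5 := mul_le_mul_of_nonneg_left hm (by positivity : 0 ≤ k ^ 2 * b)
  have t6 : 0 ≤ b * (A + B) * (k * (k - 4 * a)) :=
    mul_nonneg (by positivity) (mul_nonneg hk0.le (by linarith))
  have t7 : 0 ≤ k * a * s * A := by positivity
  have t8 : 0 ≤ k ^ 2 * b * B := by positivity
  have main : -k * (k * (I + b * (c + m)) + a * J) + k ^ 2 * s * A / 2 + k ^ 2 * F' ≤
      (k - 1) ^ 2 * F - (a - 2) * (k * F) - b / 8 * (k ^ 2 * (B + A))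
        + s / 2 * (k ^ 2 * E) + 2 * b * (k ^ 2 * N) := by
    nlinarith
  have := mul_le_mul_of_nonneg_left main hs.le
  linarith

/-- One-step decrease of the kinetic energy. -/
lemma kinetic_step_le {u d G g p M e : H} {k a b s F F' : ℝ} (hs : 0 < s) (hb : 0 < b)
    (ha : 2 < a) (hk : 4 * a ≤ k) (hF : 0 ≤ F)
    (hQ : k • (u - s • (p + e) + b • (g + M)) =
      (k - 1) • (d + b • G) - a • d - (k * s) • (p + e))
    (h1 : F' ≤ F + inner ℝ p u - s / 2 * ‖p‖ ^ 2 + s / 2 * ‖e‖ ^ 2) :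
    ‖k • (u - s • (p + e) + b • (g + M))‖ ^ 2 / 2 + s * k ^ 2 * F' ≤
      (1 + k * s * ‖e‖) * (‖(k - 1) • (d + b • G)‖ ^ 2 / 2 + s * (k - 1) ^ 2 * F
        - a / 2 * (k * ‖d‖ ^ 2) + (k * s * ‖e‖ / 2 + a * b ^ 2 / 2 * ‖(k - 1) • G‖ ^ 2
          + (2 * s * (k * F) + s ^ 2 * (k ^ 2 * (‖p‖ ^ 2 + ‖e‖ ^ 2))
            + s * b * (k ^ 2 * (‖p‖ ^ 2 + ‖g‖ ^ 2 + ‖M‖ ^ 2))))) := by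
  have hk0 : 0 < k := by linarith
  have hR : ‖(k - 1) • (d + b • G) - a • d‖ ^ 2 / 2 ≤ ‖(k - 1) • (d + b • G)‖ ^ 2 / 2
      - a / 2 * (k * ‖d‖ ^ 2) + a * b ^ 2 / 2 * ‖(k - 1) • G‖ ^ 2 := by
    rw [norm_sub_sq_real]
    have e1 : inner ℝ ((k - 1) • (d + b • G)) (a • d) =
        a * ((k - 1) * ‖d‖ ^ 2 + inner ℝ (b • (k - 1) • G) d) := by
      simp only [inner_add_left, real_inner_smul_left, real_inner_smul_right,
        real_inner_self_eq_norm_sq]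
      ring
    have e2 : ‖a • d‖ ^ 2 = a ^ 2 * ‖d‖ ^ 2 := by
      rw [norm_smul, mul_pow, Real.norm_eq_abs, sq_abs]
    have e3 : ‖b • (k - 1) • G‖ ^ 2 = b ^ 2 * ‖(k - 1) • G‖ ^ 2 := by
      rw [norm_smul, mul_pow, Real.norm_eq_abs, sq_abs]
    have hi := neg_two_mul_inner_le (b • (k - 1) • G) d
    rw [e3] at hi
    rw [e1, e2]
    have hi' := mul_le_mul_of_nonneg_left hi (by linarith : 0 ≤ a / 2)
    have hd : 0 ≤ ‖d‖ ^ 2 * (a * (k / 2 - 3 / 2 - a / 2)) :=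
      mul_nonneg (sq_nonneg _) (mul_nonneg (by linarith) (by linarith))
    linarith
  have hRe := half_norm_sub_smul_sq_le ((k - 1) • (d + b • G) - a • d) e
    (mul_nonneg hk0.le hs.le)
  have e4 : (k - 1) • (d + b • G) - a • d - (k * s) • e =
      k • (u - s • (p + e) + b • (g + M)) + (k * s) • p := by
    rw [hQ]; module
  rw [e4, norm_add_sq_real] at hRe
  have e5 : inner ℝ (k • (u - s • (p + e) + b • (g + M))) ((k * s) • p) =
      k * s * (k * (inner ℝ p u - s * (‖p‖ ^ 2 + inner ℝ p e)
        + b * (inner ℝ p g + inner ℝ p M))) := by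
    rw [real_inner_comm]
    simp only [inner_add_right, inner_sub_right, real_inner_smul_left, real_inner_smul_right,
      real_inner_self_eq_norm_sq]
    ring
  have e6 : ‖(k * s) • p‖ ^ 2 = k ^ 2 * s ^ 2 * ‖p‖ ^ 2 := by
    rw [norm_smul, mul_pow, Real.norm_eq_abs, sq_abs]; ring
  rw [e5, e6] at hRe
  clear hQ e4 e5 e6
  have hc := neg_two_mul_inner_le p g
  have hm := neg_two_mul_inner_le p M
  have he := two_mul_inner_le p e
  have hε : 0 ≤ k * s * ‖e‖ := by positivity
  generalize ‖k • (u - s • (p + e) + b • (g + M))‖ ^ 2 = W at *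
  generalize ‖(k - 1) • (d + b • G) - a • d‖ ^ 2 = R at *
  generalize k * s * ‖e‖ = ε at *
  have hA : 0 ≤ ‖p‖ ^ 2 := sq_nonneg _
  have hB : 0 ≤ ‖g‖ ^ 2 := sq_nonneg _
  have hN : 0 ≤ ‖M‖ ^ 2 := sq_nonneg _
  have hE : 0 ≤ ‖e‖ ^ 2 := sq_nonneg _
  generalize ‖p‖ ^ 2 = A at *
  generalize ‖g‖ ^ 2 = B at *
  generalize ‖M‖ ^ 2 = N at *
  generalize ‖e‖ ^ 2 = E at *
  set X := 2 * s * (k * F) + s ^ 2 * (k ^ 2 * (A + E)) + s * b * (k ^ 2 * (A + B + N)) with hX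
  have hX0 : 0 ≤ X := by positivity
  have hF0 : 0 ≤ s * (k - 1) ^ 2 * F := by positivity
  have main : W / 2 + s * k ^ 2 * F' ≤
      (1 + ε) * (R / 2 + ε / 2) + (s * (k - 1) ^ 2 * F + X) := by
    have t1 := mul_le_mul_of_nonneg_left h1 (by positivity : 0 ≤ s * k ^ 2)
    have t2 := mul_le_mul_of_nonneg_left (add_le_add hc hm) (by positivity : 0 ≤ s * k ^ 2 * b / 2)
    have t3 := mul_le_mul_of_nonneg_left he (by positivity : 0 ≤ s ^ 2 * k ^ 2 / 2)
    have t4 : 0 ≤ s ^ 2 * k ^ 2 * A := by positivity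
    have t5 : 0 ≤ s * k ^ 2 * b * (B + N) := by positivity
    have t6 : 0 ≤ s * F := by positivity
    rw [hX]
    linarith
  have t := mul_le_mul_of_nonneg_left hR (by linarith : 0 ≤ 1 + ε)
  have t' := mul_nonneg hε (add_nonneg hF0 hX0)
  linarith

variable [CompleteSpace H] {f : H → ℝ} {f' : H → H} {L : ℝ}

lemma hasDerivAt_comp_add_smul (hdiff : ∀ z, HasGradientAt f (f' z) z) (y v : H) (t : ℝ) :
    HasDerivAt (fun t : ℝ => f (y + t • v)) (inner ℝ (f' (y + t • v)) v) t := by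
  have h1 : HasDerivAt (fun t : ℝ => y + t • v) v t := by
    simpa using ((hasDerivAt_id t).smul_const v).const_add y
  exact (hdiff (y + t • v)).hasFDerivAt.comp_hasDerivAt t h1

/-- The first-order characterization of convexity. -/
lemma ConvexOn.add_inner_gradient_le (hconv : ConvexOn ℝ Set.univ f)
    (hdiff : ∀ z, HasGradientAt f (f' z) z) (y v : H) :
    f y + inner ℝ (f' y) v ≤ f (y + v) := by
  have hc : ConvexOn ℝ Set.univ (fun t : ℝ => f (y + t • v)) := by
    have := hconv.comp_affineMap (AffineMap.lineMap y (y + v) : ℝ →ᵃ[ℝ] H)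
    simpa [Function.comp_def, AffineMap.lineMap_apply, add_comm] using this
  have := hc.le_slope_of_hasDerivAt (Set.mem_univ 0) (Set.mem_univ 1) one_pos
    (hasDerivAt_comp_add_smul hdiff y v 0)
  simp [slope_def_field] at this
  linarith

/-- The descent lemma. -/
lemma le_add_inner_gradient_add_sq (hdiff : ∀ z, HasGradientAt f (f' z) z)
    (hlip : ∀ z w, ‖f' z - f' w‖ ≤ L * ‖z - w‖) (y v : H) :
    f (y + v) ≤ f y + inner ℝ (f' y) v + L / 2 * ‖v‖ ^ 2 := by
  have hd : ∀ t : ℝ, HasDerivAt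
      (fun t : ℝ => f (y + t • v) - t * inner ℝ (f' y) v - L / 2 * ‖v‖ ^ 2 * t ^ 2)
      (inner ℝ (f' (y + t • v)) v - inner ℝ (f' y) v - L * ‖v‖ ^ 2 * t) t := by
    intro t
    have h1 := (hasDerivAt_comp_add_smul hdiff y v t).sub
      ((hasDerivAt_id t).mul_const (inner ℝ (f' y) v))
    have h2 := h1.sub ((hasDerivAt_pow 2 t).const_mul (L / 2 * ‖v‖ ^ 2))
    refine h2.congr_deriv ?_
    simp
    ring
  have hanti := antitoneOn_of_deriv_nonpos (convex_Icc (0 : ℝ) 1)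
    (fun t _ => (hd t).continuousAt.continuousWithinAt)
    (fun t _ => (hd t).differentiableAt.differentiableWithinAt) (fun t ht => by
      rw [interior_Icc] at ht
      rw [(hd t).deriv, ← inner_sub_left]
      have h1 := real_inner_le_norm (f' (y + t • v) - f' y) v
      have h2 := hlip (y + t • v) y
      rw [add_sub_cancel_left, norm_smul, Real.norm_eq_abs, abs_of_pos ht.1] at h2
      have h3 := mul_le_mul_of_nonneg_right h2 (norm_nonneg v)
      nlinarith)
  have := hanti (Set.left_mem_Icc.2 zero_le_one) (Set.right_mem_Icc.2 zero_le_one) zero_le_one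
  simp at this
  linarith

/-- The strengthened gradient inequality for a convex function with Lipschitz gradient. -/
lemma ConvexOn.add_inner_gradient_add_sq_le {s : ℝ} (hconv : ConvexOn ℝ Set.univ f)
    (hdiff : ∀ z, HasGradientAt f (f' z) z) (hlip : ∀ z w, ‖f' z - f' w‖ ≤ L * ‖z - w‖)
    (hs : 0 < s) (hsL : L * s ≤ 1) (y w : H) :
    f y + inner ℝ (f' y) (w - y) + s / 2 * ‖f' w - f' y‖ ^ 2 ≤ f w := by
  have h1 := le_add_inner_gradient_add_sq hdiff hlip w (-(s • (f' w - f' y)))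
  have h2 := hconv.add_inner_gradient_le hdiff y (w - s • (f' w - f' y) - y)
  rw [show y + (w - s • (f' w - f' y) - y) = w + -(s • (f' w - f' y)) by abel] at h2
  have e1 : inner ℝ (f' y) (w - s • (f' w - f' y) - y) =
      inner ℝ (f' y) (w - y) - s * inner ℝ (f' y) (f' w - f' y) := by
    rw [show w - s • (f' w - f' y) - y = w - y - s • (f' w - f' y) by abel, inner_sub_right,
      inner_smul_right]
  have e2 : inner ℝ (f' w) (f' w - f' y) =
      ‖f' w - f' y‖ ^ 2 + inner ℝ (f' y) (f' w - f' y) := by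
    rw [← real_inner_self_eq_norm_sq, ← inner_add_left, sub_add_cancel]
  rw [norm_neg, norm_smul, mul_pow, Real.norm_eq_abs, sq_abs, inner_neg_right, inner_smul_right,
    e2] at h1
  rw [e1] at h2
  have := mul_nonneg (mul_nonneg hs.le (by linarith : 0 ≤ 1 - L * s)) (sq_nonneg ‖f' w - f' y‖)
  linarith

/-- Decrease of the objective along an inexact gradient step from `y`, compared with any `w`. -/
lemma inexact_gradient_step_le {s : ℝ} (hconv : ConvexOn ℝ Set.univ f)
    (hdiff : ∀ z, HasGradientAt f (f' z) z) (hlip : ∀ z w, ‖f' z - f' w‖ ≤ L * ‖z - w‖)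
    (hs : 0 < s) (hsL : L * s ≤ 1) (y w e : H) :
    f (y - s • (f' y + e)) ≤ f w + inner ℝ (f' y) (y - w) - s / 2 * ‖f' y‖ ^ 2
      - s / 2 * ‖f' w - f' y‖ ^ 2 + s / 2 * ‖e‖ ^ 2 := by
  have h1 := le_add_inner_gradient_add_sq hdiff hlip y (-(s • (f' y + e)))
  have h2 := hconv.add_inner_gradient_add_sq_le hdiff hlip hs hsL y w
  rw [← neg_sub y w, inner_neg_right] at h2
  rw [norm_neg, norm_smul, mul_pow, Real.norm_eq_abs, sq_abs, inner_neg_right, inner_smul_right,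
    ← sub_eq_add_neg, inner_add_right, real_inner_self_eq_norm_sq] at h1
  have h3 := norm_add_sq_real (f' y) e
  have := mul_nonneg (mul_nonneg hs.le (by linarith : 0 ≤ 1 - L * s)) (sq_nonneg ‖f' y + e‖)
  nlinarith

end InnerProduct

/-- Square-summability of the velocity for the iteration with indices shifted so that no truncated
subtraction occurs. -/
lemma summable_velocity_of_recursion {H : Type*} [NormedAddCommGroup H] [InnerProductSpace ℝ H]
    [CompleteSpace H] {f : H → ℝ} {f' : H → H} {L : ℝ} (hconv : ConvexOn ℝ Set.univ f)
    (hdiff : ∀ z, HasGradientAt f (f' z) z) (hlip : ∀ z w, ‖f' z - f' w‖ ≤ L * ‖z - w‖)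
    {z : H} (hmin : ∀ w, f z ≤ f w) {α s b : ℝ} (hα : 3 < α) (hs : 0 < s) (hsL : L * s ≤ 1)
    (hb : 0 < b) (hbs : b ≤ s / 2) {x y M e : ℕ → H}
    (hy : ∀ n : ℕ, ((n : ℝ) + 1) • (y n - x (n + 1) + b • (f' (x (n + 1)) + M (n + 1))) =
      ((n : ℝ) + 1 - α) • (x (n + 1) - x n) + (n * b) • (f' (x n) + M n))
    (hx : ∀ n, x (n + 2) = y n - s • (f' (y n) + e n))
    (hM : Summable fun n : ℕ => (n : ℝ) * ‖M n‖)
    (he : Summable fun n : ℕ => ((n : ℝ) + 1) * ‖e n‖) :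
    Summable fun n : ℕ => ((n : ℝ) + 1) * ‖x (n + 1) - x n‖ ^ 2 := by
  have hgz : f' z = 0 := by
    have h : IsLocalMin f z := Filter.Eventually.of_forall hmin
    simpa using h.hasFDerivAt_eq_zero (hdiff z).hasFDerivAt
  obtain ⟨N, hN⟩ := exists_nat_ge (4 * (α - 1))
  have hk : ∀ n, N ≤ n → 4 * (α - 1) ≤ (n : ℝ) + 1 := fun n hn => by
    have : (N : ℝ) ≤ n := by exact_mod_cast hn
    linarith
  have hF : ∀ n, 0 ≤ f (x n) - f z := fun n => sub_nonneg.2 (hmin _)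
  have hstep : ∀ n w, f (x (n + 2)) ≤ f w + inner ℝ (f' (y n)) (y n - w)
      - s / 2 * ‖f' (y n)‖ ^ 2 - s / 2 * ‖f' w - f' (y n)‖ ^ 2 + s / 2 * ‖e n‖ ^ 2 := fun n w => by
    rw [hx]
    exact inexact_gradient_step_le hconv hdiff hlip hs hsL _ _ _
  have sM : Summable fun n : ℕ => ((n : ℝ) + 1) ^ 2 * ‖M (n + 1)‖ ^ 2 := by
    have := (summable_nat_add_iff 1).2 (hM.sq_of_nonneg fun n => by positivity)
    simpa [mul_pow] using this
  have se : Summable fun n : ℕ => ((n : ℝ) + 1) ^ 2 * ‖e n‖ ^ 2 := by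
    have := he.sq_of_nonneg fun n => by positivity
    simpa [mul_pow] using this
  have sε : Summable fun n : ℕ => ((n : ℝ) + 1) * s * ‖e n‖ :=
    (he.mul_left s).congr fun n => by ring
  -- first energy estimate: values and gradients
  have henergy : Summable fun n : ℕ =>
      s * (α - 1 - 2) * (((n : ℝ) + 1) * (f (x (n + 1)) - f z)) + s * b / 8 *
        (((n : ℝ) + 1) ^ 2 * (‖f' (x (n + 1))‖ ^ 2 + ‖f' (y n)‖ ^ 2)) := by
    have hD : ∀ n : ℕ, 0 ≤ s * (α - 1 - 2) * (((n : ℝ) + 1) * (f (x (n + 1)) - f z)) + s * b / 8 *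
        (((n : ℝ) + 1) ^ 2 * (‖f' (x (n + 1))‖ ^ 2 + ‖f' (y n)‖ ^ 2)) := fun n => by
      have h1 := hF (n + 1)
      have h2 : 0 < α - 1 - 2 := by linarith
      positivity
    refine summable_of_le_one_add_mul_of_ge
      (a := fun n : ℕ => ‖(n : ℝ) • (x (n + 1) - x n + b • (f' (x n) + M n))
          + (α - 1) • (x n - z)‖ ^ 2 / 2 + s * (n : ℝ) ^ 2 * (f (x (n + 1)) - f z))
      (h := fun n : ℕ => ((n : ℝ) + 1) * s * ‖e n‖ / 2
        + (s ^ 2 / 2 * (((n : ℝ) + 1) ^ 2 * ‖e n‖ ^ 2)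
          + 2 * s * b * (((n : ℝ) + 1) ^ 2 * ‖M (n + 1)‖ ^ 2)))
      (ε := fun n : ℕ => ((n : ℝ) + 1) * s * ‖e n‖) N
      (fun n => by have h1 := hF (n + 1); positivity) hD
      (fun n => by positivity) (fun n => by positivity)
      ((sε.div_const 2).add ((se.mul_left _).add (sM.mul_left _))) sε fun n hn => ?_
    have hw : (n : ℝ) • (x (n + 1) - x n + b • (f' (x n) + M n)) + (α - 1) • (x n - z) =
        ((n : ℝ) + 1) • (y n - x (n + 1) + b • (f' (x (n + 1)) + M (n + 1)))
          + (α - 1) • (x (n + 1) - z) := by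
      rw [hy]; module
    have hw' : ((n + 1 : ℕ) : ℝ) • (x (n + 1 + 1) - x (n + 1) + b • (f' (x (n + 1)) + M (n + 1)))
          + (α - 1) • (x (n + 1) - z) =
        ((n : ℝ) + 1) • (y n - x (n + 1) + b • (f' (x (n + 1)) + M (n + 1)))
          + (α - 1) • (x (n + 1) - z) - (((n : ℝ) + 1) * s) • f' (y n)
          - (((n : ℝ) + 1) * s) • e n := by
      rw [hx]; push_cast; module
    have h1 := hstep n (x (n + 1))
    have h2 := hstep n z
    rw [hgz, zero_sub, norm_neg] at h2
    have hE := energy_step_le (u := y n - x (n + 1)) (g := f' (x (n + 1))) (p := f' (y n))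
      (M := M (n + 1)) (q := x (n + 1) - z) (k := (n : ℝ) + 1) (F := f (x (n + 1)) - f z)
      (F' := f (x (n + 2)) - f z) (E := ‖e n‖ ^ 2) hs hb hbs (by linarith : 2 < α - 1) (hk n hn)
      (hF _) (by linarith) (by rw [sub_add_sub_cancel]; linarith)
    have hnoise := half_norm_sub_smul_sq_le
      (((n : ℝ) + 1) • (y n - x (n + 1) + b • (f' (x (n + 1)) + M (n + 1)))
        + (α - 1) • (x (n + 1) - z) - (((n : ℝ) + 1) * s) • f' (y n)) (e n)
      (by positivity : 0 ≤ ((n : ℝ) + 1) * s)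
    rw [hw, hw']
    push_cast
    rw [add_sub_cancel_right] at hE
    have hε : 0 ≤ ((n : ℝ) + 1) * s * ‖e n‖ := by positivity
    have hF' : 0 ≤ s * ((n : ℝ) + 1) ^ 2 * (f (x (n + 2)) - f z) := by
      have := hF (n + 2); positivity
    have hE' := mul_le_mul_of_nonneg_left hE (by linarith : 0 ≤ 1 + ((n : ℝ) + 1) * s * ‖e n‖)
    have := mul_nonneg hε hF'
    rw [show n + 1 + 1 = n + 2 from rfl]
    linarith
  have sF : Summable fun n : ℕ => ((n : ℝ) + 1) * (f (x (n + 1)) - f z) := by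
    have hc : 0 < s * (α - 1 - 2) := mul_pos hs (by linarith)
    refine (summable_mul_left_iff hc.ne').1
      (henergy.of_nonneg_of_le (fun n => ?_) fun n => le_add_of_nonneg_right (by positivity))
    have h1 := hF (n + 1)
    positivity
  have sgp : Summable fun n : ℕ =>
      ((n : ℝ) + 1) ^ 2 * (‖f' (x (n + 1))‖ ^ 2 + ‖f' (y n)‖ ^ 2) := by
    have hc : 0 < s * b / 8 := by positivity
    refine (summable_mul_left_iff hc.ne').1
      (henergy.of_nonneg_of_le (fun n => by positivity) fun n => le_add_of_nonneg_left ?_)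
    have h1 := hF (n + 1)
    have h2 : 0 < α - 1 - 2 := by linarith
    positivity
  have sg : Summable fun n : ℕ => ((n : ℝ) + 1) ^ 2 * ‖f' (x (n + 1))‖ ^ 2 :=
    sgp.of_nonneg_of_le (fun n => by positivity) fun n => by
      gcongr; exact le_add_of_nonneg_right (sq_nonneg _)
  have sp : Summable fun n : ℕ => ((n : ℝ) + 1) ^ 2 * ‖f' (y n)‖ ^ 2 :=
    sgp.of_nonneg_of_le (fun n => by positivity) fun n => by
      gcongr; exact le_add_of_nonneg_left (sq_nonneg _)
  have sG : Summable fun n : ℕ => ‖(n : ℝ) • (f' (x n) + M n)‖ ^ 2 := by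
    rw [← summable_nat_add_iff 1]
    refine ((sg.mul_left 2).add (sM.mul_left 2)).of_nonneg_of_le (fun n => by positivity)
      fun n => ?_
    rw [norm_smul, mul_pow, Real.norm_eq_abs, sq_abs]
    push_cast
    have := mul_le_mul_of_nonneg_left (norm_add_sq_le_two_mul (f' (x (n + 1))) (M (n + 1)))
      (sq_nonneg ((n : ℝ) + 1))
    linarith
  -- second energy estimate: velocities
  have hkinetic : Summable fun n : ℕ =>
      (α - 1) / 2 * (((n : ℝ) + 1) * ‖x (n + 1) - x n‖ ^ 2) := by
    have ha : 0 < α - 1 := by linarith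
    refine summable_of_le_one_add_mul_of_ge
      (a := fun n : ℕ => ‖(n : ℝ) • (x (n + 1) - x n + b • (f' (x n) + M n))‖ ^ 2 / 2
          + s * (n : ℝ) ^ 2 * (f (x (n + 1)) - f z))
      (h := fun n : ℕ => ((n : ℝ) + 1) * s * ‖e n‖ / 2
        + (α - 1) * b ^ 2 / 2 * ‖(n : ℝ) • (f' (x n) + M n)‖ ^ 2
        + (2 * s * (((n : ℝ) + 1) * (f (x (n + 1)) - f z))
          + s ^ 2 * (((n : ℝ) + 1) ^ 2 * (‖f' (y n)‖ ^ 2 + ‖e n‖ ^ 2))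
          + s * b * (((n : ℝ) + 1) ^ 2 *
            (‖f' (y n)‖ ^ 2 + ‖f' (x (n + 1))‖ ^ 2 + ‖M (n + 1)‖ ^ 2))))
      (ε := fun n : ℕ => ((n : ℝ) + 1) * s * ‖e n‖) N
      (fun n => by have h1 := hF (n + 1); positivity) (fun n => by positivity)
      (fun n => by have h1 := hF (n + 1); positivity) (fun n => by positivity) ?_ sε fun n hn => ?_
    · refine ((sε.div_const 2).add (sG.mul_left _)).add
        (((sF.mul_left _).add (Summable.mul_left _ ?_)).add (Summable.mul_left _ ?_))
      · exact (sp.add se).congr fun n => by ring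
      · exact ((sp.add sg).add sM).congr fun n => by ring
    have h1 := hstep n (x (n + 1))
    have h1' : 0 ≤ s / 2 * ‖f' (x (n + 1)) - f' (y n)‖ ^ 2 := by positivity
    have hK := kinetic_step_le (u := y n - x (n + 1)) (d := x (n + 1) - x n)
      (G := f' (x n) + M n) (g := f' (x (n + 1))) (p := f' (y n)) (M := M (n + 1)) (e := e n)
      (k := (n : ℝ) + 1) (a := α - 1) (F := f (x (n + 1)) - f z) (F' := f (x (n + 2)) - f z)
      hs hb (by linarith) (hk n hn) (hF _)
      (by
        have := hy n
        calc _ = ((n : ℝ) + 1) • (y n - x (n + 1) + b • (f' (x (n + 1)) + M (n + 1)))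
            - (((n : ℝ) + 1) * s) • (f' (y n) + e n) := by module
          _ = _ := by rw [this]; module)
      (by linarith)
    have hv : y n - x (n + 1) - s • (f' (y n) + e n) = x (n + 2) - x (n + 1) := by
      rw [hx]; abel
    rw [hv, add_sub_cancel_right] at hK
    push_cast
    exact hK
  have hc : (α - 1) / 2 ≠ 0 := by linarith
  exact (summable_mul_left_iff hc).1 hkinetic

/-- Theorem 2.1(iv)(b): with constant step-size, `Σ k ‖x_k − x_{k−1}‖² < ∞`. -/
theorem igahd_velocity_summable
    {H : Type*} [NormedAddCommGroup H] [InnerProductSpace ℝ H] [CompleteSpace H]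
    (f : H → ℝ) (f' : H → H) (L : ℝ) (hL : 0 < L)
    (hconv : ConvexOn ℝ Set.univ f)
    (hdiff : ∀ z, HasGradientAt f (f' z) z)
    (hlip : ∀ z w, ‖f' z - f' w‖ ≤ L * ‖z - w‖)
    (xstar : H) (hmin : ∀ z, f xstar ≤ f z)
    (α : ℝ) (hα : 3 < α)
    (s β : ℕ → ℝ) (hs0 : s 0 = 0) (hβ0 : β 0 = 0)
    -- constant step-size `s_k ≡ sc ∈ (0, 1/L]` and damping `β_k ≡ η √sc / 2`
    (sc : ℝ) (hsc_pos : 0 < sc) (hsc_le : sc ≤ 1 / L)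
    (hs_const : ∀ k, 1 ≤ k → s k = sc)
    (η : ℝ) (hη0 : 0 < η) (hη1 : η ≤ 1)
    (hβ : ∀ k, 1 ≤ k → β k = η * Real.sqrt sc / 2)
    (x y Mx My : ℕ → H)
    (hx_init : x 1 = x 0)
    (hy : ∀ k, 1 ≤ k → y k = x k + (1 - α / (k : ℝ)) • (x k - x (k - 1))
        - (β k * Real.sqrt (s k)) • (f' (x k) + Mx k)
        + (β (k - 1) * Real.sqrt (s (k - 1)) * (1 - 1 / (k : ℝ))) •
            (f' (x (k - 1)) + Mx (k - 1)))
    (hx : ∀ k, 1 ≤ k → x (k + 1) = y k - s k • (f' (y k) + My k))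
    (hJ0x : Summable fun k : ℕ => s k * (k : ℝ) * ‖Mx k‖)
    (hJ0y : Summable fun k : ℕ => s k * (k : ℝ) * ‖My k‖) :
    Summable fun k : ℕ => (k : ℝ) * ‖x k - x (k - 1)‖ ^ 2 := by
  have hroot : 0 < Real.sqrt sc := Real.sqrt_pos.2 hsc_pos
  have hsq : Real.sqrt sc * Real.sqrt sc = sc := Real.mul_self_sqrt hsc_pos.le
  have hb : ∀ k, 1 ≤ k → β k * Real.sqrt (s k) = η * sc / 2 := fun k hk => by
    rw [hβ k hk, hs_const k hk]
    linear_combination η / 2 * hsq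
  have hM : Summable fun n : ℕ => (n : ℝ) * ‖Mx n‖ := by
    refine (summable_mul_left_iff hsc_pos.ne').1 (hJ0x.congr fun n => ?_)
    rcases n with _ | n
    · simp
    · rw [hs_const _ (by omega), mul_assoc]
  have he : Summable fun n : ℕ => ((n : ℝ) + 1) * ‖My (n + 1)‖ := by
    refine (summable_mul_left_iff hsc_pos.ne').1
      (((summable_nat_add_iff 1).2 hJ0y).congr fun n => ?_)
    rw [hs_const _ (by omega), mul_assoc]
    push_cast
    rfl
  rw [← summable_nat_add_iff 1]
  have hsL : L * sc ≤ 1 := by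
    rw [le_div_iff₀ hL] at hsc_le
    linarith
  have := summable_velocity_of_recursion (x := x) (y := fun n => y (n + 1)) (M := Mx)
    (e := fun n => My (n + 1)) (b := η * sc / 2) hconv hdiff hlip hmin hα hsc_pos hsL
    (by positivity) (by nlinarith) (fun n => ?_) (fun n => ?_) hM he
  · simpa using this
  · have hn : (n : ℝ) + 1 ≠ 0 := by positivity
    have hcoef : β n * Real.sqrt (s n) * (1 - 1 / ((n : ℝ) + 1)) =
        η * sc / 2 * (1 - 1 / ((n : ℝ) + 1)) := by
      rcases n with _ | n
      · simp
      · rw [hb _ (by omega)]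
    have h := hy (n + 1) (by omega)
    rw [hb _ (by omega), Nat.add_sub_cancel, Nat.cast_add_one, hcoef] at h
    rw [h]
    match_scalars <;> field_simp <;> ring
  · simpa [hs_const] using hx (n + 1) (by omega)
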